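/- For every smooth matrix field S : ℝ³ → ℝ^{3×3} one has Div(RotRot^⊤ S) = 0, i.e. the second complex property of the elasticity complex holds on smooth fields. -/

import Mathlib

open Matrix

noncomputable section

/-- Points of `ℝ³`. -/
abbrev V3 := Fin 3 → ℝ
/-- Real `3×3` matrices. -/
abbrev M3 := Matrix (Fin 3) (Fin 3) ℝ

/-- Partial derivative `∂ᵢ f` of a scalar function on `ℝ³`. -/
def pd (i : Fin 3) (f : V3 → ℝ) (x : V3) : ℝ := fderiv ℝ f x (Pi.single i 1)

/-- Gradient of a scalar function. -/
def grad (f : V3 → ℝ) (x : V3) : V3 := fun i => pd i f x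

/-- Divergence of a vector field. -/
def vdiv (v : V3 → V3) (x : V3) : ℝ := ∑ i, pd i (fun y => v y i) x

/-- Curl (rotation) of a vector field. -/
def vrot (v : V3 → V3) (x : V3) : V3 :=
  ![pd 1 (fun y => v y 2) x - pd 2 (fun y => v y 1) x,
    pd 2 (fun y => v y 0) x - pd 0 (fun y => v y 2) x,
    pd 0 (fun y => v y 1) x - pd 1 (fun y => v y 0) x]

/-- Jacobian matrix `(Grad v)_{ij} = ∂_j v_i` of a vector field. -/
def vGrad (v : V3 → V3) (x : V3) : M3 := Matrix.of fun i j => pd j (fun y => v y i) x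

/-- Row-wise curl of a matrix field. -/
def mRot (S : V3 → M3) (x : V3) : M3 := Matrix.of fun i => vrot (fun y => S y i) x

/-- Row-wise divergence of a matrix field. -/
def mDiv (S : V3 → M3) (x : V3) : V3 := fun i => vdiv (fun y => S y i) x

/-- The second order operator `RotRot^⊤ S = Rot ((Rot S)ᵀ)`. -/
def rotRotT (S : V3 → M3) (x : V3) : M3 := mRot (fun y => (mRot S y)ᵀ) x

/-- Symmetric part of a matrix. -/
def msym (M : M3) : M3 := (2⁻¹ : ℝ) • (M + Mᵀ)

/-- Skew-symmetric part of a matrix. -/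
def mskw (M : M3) : M3 := (2⁻¹ : ℝ) • (M - Mᵀ)

/-- Deviatoric (trace-free) part of a matrix. -/
def mdev (M : M3) : M3 := M - (Matrix.trace M / 3) • (1 : M3)

/-- The skew-symmetric matrix `spn w` with `(spn w) x = w × x`. -/
def spn (w : V3) : M3 := !![0, -w 2, w 1; w 2, 0, -w 0; -w 1, w 0, 0]

/-- The axial vector of a (skew-symmetric) matrix; inverse of `spn`. -/
def spnInv (M : M3) : V3 := ![M 2 1, M 0 2, M 1 0]

end

/-- Partial derivatives of smooth functions are smooth. -/
theorem contDiff_pd {f : V3 → ℝ} (hf : ContDiff ℝ (⊤ : ℕ∞) f) (i : Fin 3) :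
    ContDiff ℝ (⊤ : ℕ∞) (pd i f) :=
  (hf.fderiv_right le_rfl).clm_apply contDiff_const

/-- Partial derivatives commute with subtraction of smooth functions. -/
theorem pd_sub {f g : V3 → ℝ} (hf : ContDiff ℝ (⊤ : ℕ∞) f) (hg : ContDiff ℝ (⊤ : ℕ∞) g)
    (i : Fin 3) (x : V3) :
    pd i (fun y => f y - g y) x = pd i f x - pd i g x := by
  simp only [pd]
  rw [fderiv_fun_sub (hf.differentiable (by simp) x) (hg.differentiable (by simp) x)]
  rfl

/-- Partial derivatives of a smooth function commute. -/
theorem pd_comm {f : V3 → ℝ} (hf : ContDiff ℝ (⊤ : ℕ∞) f) (i j : Fin 3) (x : V3) :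
    pd i (pd j f) x = pd j (pd i f) x := by
  have hd : DifferentiableAt ℝ (fderiv ℝ f) x :=
    (hf.fderiv_right (m := (⊤ : ℕ∞)) le_rfl).differentiable (by simp) x
  have key (a b : Fin 3) :
      pd a (pd b f) x = fderiv ℝ (fderiv ℝ f) x (Pi.single a 1) (Pi.single b 1) := by
    change fderiv ℝ (fun y => fderiv ℝ f y (Pi.single b 1)) x (Pi.single a 1) = _
    rw [fderiv_clm_apply hd (differentiableAt_const _)]
    simp
  rw [key, key]
  exact (hf.contDiffAt.isSymmSndFDerivAt
    (by simpa using WithTop.coe_le_coe.2 (le_top : (2 : ℕ∞) ≤ ⊤))) _ _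

/-- The curl of a smooth vector field is smooth. -/
theorem contDiff_vrot {v : V3 → V3} (hv : ∀ j, ContDiff ℝ (⊤ : ℕ∞) fun y => v y j) (j : Fin 3) :
    ContDiff ℝ (⊤ : ℕ∞) fun y => vrot v y j := by
  fin_cases j <;> exact (contDiff_pd (hv _) _).sub (contDiff_pd (hv _) _)

/-- The divergence of the curl of a smooth vector field vanishes. -/
theorem vdiv_vrot {v : V3 → V3} (hv : ∀ j, ContDiff ℝ (⊤ : ℕ∞) fun y => v y j) (x : V3) :
    vdiv (vrot v) x = 0 := by
  have hsub (i a b c d : Fin 3) :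
      pd i (fun y => pd a (fun z => v z b) y - pd c (fun z => v z d) y) x =
        pd i (pd a fun z => v z b) x - pd i (pd c fun z => v z d) x :=
    pd_sub (contDiff_pd (hv b) a) (contDiff_pd (hv d) c) i x
  simp only [vdiv, Fin.sum_univ_three, vrot, Matrix.cons_val, hsub]
  rw [pd_comm (hv 2) 1 0, pd_comm (hv 1) 2 0, pd_comm (hv 0) 2 1]
  ring

/-- Second complex property of the elasticity complex: `Div (RotRot^⊤ S) = 0`. -/
theorem div_rotRotT_eq_zero (S : V3 → M3)
    (hS : ∀ i j, ContDiff ℝ (⊤ : ℕ∞) fun y => S y i j) :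
    ∀ x, mDiv (rotRotT S) x = 0 := by
  intro x
  funext i
  exact vdiv_vrot (fun j => contDiff_vrot (hS j) i) x
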